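/- arXiv:1909.02187 — 2 statements merged into one kernel-verified Lean document; each statement's English description precedes it below -/
import Mathlib

section
/- Let K, T, S be positive integers with S ≤ T, let η ∈ (0, 1/2], and let ℓ_1, …, ℓ_T ∈ [0,1]^K. Let w_1 be any element of the clipped simplex Δ̃_K, and for each t ∈ {1,…,T} let w_{t+1} be the minimizer over Δ̃_K of w ↦ ⟨w, −log(1 − ηℓ_t)⟩ + D_φ(w‖w_t), where log(1 − ηℓ_t) is applied componentwise. Then for every comparator sequence (E_1,…,E_T) ∈ [K]^T with at most S−1 switches, ∑_{t=1}^T ⟨w_t, ℓ_t⟩ − ∑_{t=1}^T ℓ_t[E_t] ≤ η·∑_{t=1}^T (ℓ_t[E_t])² + (S·log(KT/S))/η + 3S/2. -/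
open Finset

/-- The probability simplex in `ℝ^K`. -/
def stdSimplex' (K : ℕ) : Set (Fin K → ℝ) :=
  {w | (∀ i, 0 ≤ w i) ∧ ∑ i, w i = 1}

/-- The clipped simplex `Δ̃_K = {w ∈ Δ_K : w i ≥ S/(TK)}`. -/
def clippedSimplex (K T S : ℕ) : Set (Fin K → ℝ) :=
  {w | w ∈ stdSimplex' K ∧ ∀ i, (S : ℝ) / (T * K) ≤ w i}

/-- The negative Shannon entropy `φ(w) = ∑ i, w i * log (w i)`. -/
noncomputable def negEntropy {K : ℕ} (w : Fin K → ℝ) : ℝ :=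
  ∑ i, w i * Real.log (w i)

/-- The Bregman divergence with respect to the negative Shannon entropy. -/
noncomputable def breg {K : ℕ} (x y : Fin K → ℝ) : ℝ :=
  negEntropy x - negEntropy y - ∑ i, (x i - y i) * (1 + Real.log (y i))

/-- The standard inner product on `ℝ^K`. -/
def ip {K : ℕ} (x y : Fin K → ℝ) : ℝ := ∑ i, x i * y i

theorem breg_eq_sum {K : ℕ} {x y : Fin K → ℝ} (hx : ∑ i, x i = 1) (hy : ∑ i, y i = 1) :
    breg x y = ∑ i, x i * (Real.log (x i) - Real.log (y i)) := by
  have h : ∀ i, x i * (Real.log (x i) - Real.log (y i)) =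
      x i * Real.log (x i) - y i * Real.log (y i) - (x i - y i) * (1 + Real.log (y i))
        + (x i - y i) := fun i => by ring
  simp only [breg, negEntropy, h, sum_add_distrib, sum_sub_distrib, hx, hy]
  ring

/-- Bound of the Kullback-Leibler divergence by the chi-square divergence. -/
theorem mul_log_sub_log_le {v w : ℝ} (hv : 0 < v) (hw : 0 < w) :
    v * (Real.log v - Real.log w) ≤ (v - w) ^ 2 / w + (v - w) := by
  rw [← Real.log_div hv.ne' hw.ne']
  calc v * Real.log (v / w) ≤ v * (v / w - 1) :=
        mul_le_mul_of_nonneg_left (Real.log_le_sub_one_of_pos (div_pos hv hw)) hv.le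
    _ = (v - w) ^ 2 / w + (v - w) := by field_simp; ring

theorem nonneg_of_forall_mul_add_sq_mul_nonneg {a c : ℝ}
    (h : ∀ s : ℝ, 0 < s → s ≤ 1 → 0 ≤ s * a + s ^ 2 * c) : 0 ≤ a := by
  by_contra! ha
  have hc : 0 < |c| + 1 := by positivity
  have hd : 0 < -a + (|c| + 1) := by linarith
  have hs : 0 < -a / (-a + (|c| + 1)) := div_pos (by linarith) hd
  have hs1 : -a / (-a + (|c| + 1)) ≤ 1 := by rw [div_le_one hd]; linarith
  have key := h _ hs hs1
  set s := -a / (-a + (|c| + 1)) with hsdef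
  have hmul : s * (-a + (|c| + 1)) = -a := div_mul_cancel₀ _ hd.ne'
  have h1 : 0 ≤ a + s * c := by
    have : 0 ≤ s * (a + s * c) := by nlinarith
    exact nonneg_of_mul_nonneg_right this hs
  nlinarith [mul_le_mul_of_nonneg_left (le_abs_self c) hs.le, mul_pos hs (neg_pos.mpr ha)]

theorem neg_log_one_sub_le {x : ℝ} (h0 : 0 ≤ x) (h1 : x ≤ 1 / 2) :
    -Real.log (1 - x) ≤ x + x ^ 2 := by
  have hx : 0 < 1 - x := by linarith
  have hexp := Real.quadratic_le_exp_of_nonneg (show 0 ≤ x + x ^ 2 by positivity)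
  rw [neg_le, Real.le_log_iff_exp_le hx, Real.exp_neg, inv_le_comm₀ (Real.exp_pos _) hx]
  refine le_trans ?_ hexp
  rw [inv_le_iff_one_le_mul₀ hx]
  have h2 : 0 ≤ 1 - x - x ^ 2 - x ^ 3 := by nlinarith [mul_nonneg h0 h0]
  nlinarith [mul_nonneg (mul_nonneg h0 h0) h2]

section ClippedSimplex

variable {K T S : ℕ}

theorem clippedSimplex_combo_mem {u v : Fin K → ℝ} (hu : u ∈ clippedSimplex K T S)
    (hv : v ∈ clippedSimplex K T S) {s : ℝ} (hs : 0 ≤ s) (hs1 : s ≤ 1) :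
    (fun i => v i + s * (u i - v i)) ∈ clippedSimplex K T S := by
  obtain ⟨⟨hu0, hu1⟩, hu2⟩ := hu
  obtain ⟨⟨hv0, hv1⟩, hv2⟩ := hv
  refine ⟨⟨fun i => ?_, ?_⟩, fun i => ?_⟩
  · nlinarith [mul_nonneg hs (hu0 i), mul_nonneg (sub_nonneg.mpr hs1) (hv0 i)]
  · rw [sum_add_distrib, ← mul_sum, sum_sub_distrib, hu1, hv1]
    ring
  · nlinarith [mul_le_mul_of_nonneg_left (hu2 i) hs,
      mul_le_mul_of_nonneg_left (hv2 i) (sub_nonneg.mpr hs1)]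

theorem clippedSimplex_pos (hK : 0 < K) (hT : 0 < T) (hS : 0 < S) {w : Fin K → ℝ}
    (hw : w ∈ clippedSimplex K T S) (i : Fin K) : 0 < w i :=
  lt_of_lt_of_le (by positivity) (hw.2 i)

theorem clippedSimplex_log_nonpos {w : Fin K → ℝ} (hw : w ∈ clippedSimplex K T S) (i : Fin K) :
    Real.log (w i) ≤ 0 :=
  Real.log_nonpos (hw.1.1 i)
    (hw.1.2 ▸ single_le_sum (fun j _ => hw.1.1 j) (mem_univ i))

theorem clippedSimplex_neg_log_le (hK : 0 < K) (hT : 0 < T) (hS : 0 < S) {w : Fin K → ℝ}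
    (hw : w ∈ clippedSimplex K T S) (i : Fin K) :
    -Real.log (K * T / S) ≤ Real.log (w i) := by
  rw [← Real.log_inv, inv_div, mul_comm (K : ℝ)]
  exact Real.log_le_log (by positivity) (hw.2 i)

/-- First-order optimality condition for the mirror descent step on the clipped simplex. -/
theorem clippedSimplex_first_order (hK : 0 < K) (hT : 0 < T) (hS : 0 < S)
    {c w w' u : Fin K → ℝ} (hw : w ∈ clippedSimplex K T S) (hw' : w' ∈ clippedSimplex K T S)
    (hmin : ∀ v ∈ clippedSimplex K T S, ip w' c + breg w' w ≤ ip v c + breg v w)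
    (hu : u ∈ clippedSimplex K T S) :
    0 ≤ ∑ i, (u i - w' i) * (c i + Real.log (w' i) - Real.log (w i)) := by
  refine nonneg_of_forall_mul_add_sq_mul_nonneg (c := ∑ i, (u i - w' i) ^ 2 / w' i)
    fun s hs hs1 => ?_
  have hv := clippedSimplex_combo_mem hu hw' hs.le hs1
  have h := hmin _ hv
  rw [breg_eq_sum hw'.1.2 hw.1.2, breg_eq_sum hv.1.2 hw.1.2] at h
  have hsum : ∑ i, s * (u i - w' i) = 0 := by
    rw [← mul_sum, sum_sub_distrib, hu.1.2, hw'.1.2]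
    ring
  have hle : ∑ i, ((w' i + s * (u i - w' i)) * c i + (w' i + s * (u i - w' i)) *
        (Real.log (w' i + s * (u i - w' i)) - Real.log (w i)))
      ≤ ∑ i, (w' i * c i + w' i * (Real.log (w' i) - Real.log (w i))
        + s * ((u i - w' i) * (c i + Real.log (w' i) - Real.log (w i)))
        + s ^ 2 * ((u i - w' i) ^ 2 / w' i) + s * (u i - w' i)) := by
    refine sum_le_sum fun i _ => ?_
    have := mul_log_sub_log_le (clippedSimplex_pos hK hT hS hv i)
      (clippedSimplex_pos hK hT hS hw' i)
    rw [add_sub_cancel_left, mul_pow, mul_div_assoc] at this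
    linarith
  simp only [sum_add_distrib, hsum, ← mul_sum] at hle
  simp only [ip] at h
  linarith

/-- One-step regret inequality of Prod on the clipped simplex. -/
theorem clippedSimplex_prod_step (hK : 0 < K) (hT : 0 < T) (hS : 0 < S) {η : ℝ}
    {l w w' u : Fin K → ℝ} (hl : ∀ i, η * l i < 1)
    (hw : w ∈ clippedSimplex K T S) (hw' : w' ∈ clippedSimplex K T S)
    (hmin : ∀ v ∈ clippedSimplex K T S,
      ip w' (fun i => -Real.log (1 - η * l i)) + breg w' w
        ≤ ip v (fun i => -Real.log (1 - η * l i)) + breg v w)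
    (hu : u ∈ clippedSimplex K T S) :
    η * ip w l ≤ ∑ i, u i * -Real.log (1 - η * l i)
      + ∑ i, u i * (Real.log (w' i) - Real.log (w i)) := by
  have h := clippedSimplex_first_order hK hT hS hw hw' hmin hu
  have hle : ∑ i, w' i * (Real.log (1 - η * l i) + Real.log (w i) - Real.log (w' i))
      ≤ ∑ i, (w i - η * (w i * l i) - w' i) := by
    refine sum_le_sum fun i _ => ?_
    have hwi := clippedSimplex_pos hK hT hS hw i
    have hwi' := clippedSimplex_pos hK hT hS hw' i
    have hli : 0 < 1 - η * l i := sub_pos.mpr (hl i)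
    rw [← Real.log_mul hli.ne' hwi.ne', ← Real.log_div (mul_pos hli hwi).ne' hwi'.ne']
    calc _ ≤ w' i * ((1 - η * l i) * w i / w' i - 1) :=
          mul_le_mul_of_nonneg_left
            (Real.log_le_sub_one_of_pos (div_pos (mul_pos hli hwi) hwi')) hwi'.le
      _ = _ := by field_simp
  rw [sum_sub_distrib, sum_sub_distrib, hw.1.2, hw'.1.2, ← mul_sum] at hle
  have hsplit : ∑ i, (u i - w' i) * (-Real.log (1 - η * l i) + Real.log (w' i) - Real.log (w i))
      = ∑ i, u i * -Real.log (1 - η * l i) + ∑ i, u i * (Real.log (w' i) - Real.log (w i))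
        + ∑ i, w' i * (Real.log (1 - η * l i) + Real.log (w i) - Real.log (w' i)) := by
    simp only [← sum_add_distrib]
    exact sum_congr rfl fun i _ => by ring
  simp only [ip]
  linarith

theorem clippedSimplex_mix_mem (hK : 0 < K) (hT : 0 < T) (hST : S ≤ T) (j : Fin K) :
    (fun i => (1 - (S : ℝ) / T) * (if i = j then 1 else 0) + (S : ℝ) / T * (1 / K))
      ∈ clippedSimplex K T S := by
  have hr : (S : ℝ) / T ≤ 1 := (div_le_one (by positivity)).mpr (by exact_mod_cast hST)
  have hterm : ∀ i, 0 ≤ (1 - (S : ℝ) / T) * (if i = j then 1 else 0) := fun i =>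
    mul_nonneg (sub_nonneg.mpr hr) (by split_ifs <;> norm_num)
  refine ⟨⟨fun i => add_nonneg (hterm i) (by positivity), ?_⟩, fun i => ?_⟩
  · have : (K : ℝ) ≠ 0 := by positivity
    simp only [sum_add_distrib, ← mul_sum, sum_ite_eq', mem_univ, if_true, sum_const, card_univ,
      Fintype.card_fin, nsmul_eq_mul]
    field_simp
    ring
  · have : (S : ℝ) / (T * K) = S / T * (1 / K) := by field_simp
    rw [this]
    linarith [hterm i]

end ClippedSimplex

theorem sum_mix_mul {K : ℕ} (r : ℝ) (j : Fin K) (f : Fin K → ℝ) :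
    ∑ i, ((1 - r) * (if i = j then 1 else 0) + r * (1 / K)) * f i
      = (1 - r) * f j + r * (1 / K * ∑ i, f i) := by
  simp only [add_mul, sum_add_distrib, mul_assoc, ← mul_sum, ite_mul, one_mul, zero_mul,
    sum_ite_eq', mem_univ, if_true]

/-- Telescoping along a comparator sequence: each switch costs at most the range of the
potential. -/
theorem sum_tracking_le {ι : Type*} [DecidableEq ι] (a : ℕ → ι → ℝ) (E : ℕ → ι) {L : ℝ} {n : ℕ}
    (hn : 1 ≤ n) (h0 : ∀ t ∈ Icc 1 (n + 1), ∀ i, -L ≤ a t i)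
    (h1 : ∀ t ∈ Icc 1 (n + 1), ∀ i, a t i ≤ 0) :
    ∑ t ∈ Icc 1 n, (a (t + 1) (E t) - a t (E t))
      ≤ a (n + 1) (E n) + L + L * #{t ∈ Icc 2 n | E t ≠ E (t - 1)} := by
  induction n, hn using Nat.le_induction with
  | base =>
    have := h0 1 (by simp) (E 1)
    simp
    linarith
  | succ n hn ih =>
    have ih := ih (fun t ht => h0 t (by simp at ht ⊢; omega))
      (fun t ht => h1 t (by simp at ht ⊢; omega))
    have hlo := h0 (n + 1) (by simp) (E (n + 1))
    have hhi := h1 (n + 1) (by simp) (E n)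
    rw [sum_Icc_succ_top (by omega),
      ← insert_Icc_right_eq_Icc_add_one (show 2 ≤ n + 1 by omega), filter_insert]
    by_cases hE : E (n + 1) = E n
    · simp only [Nat.add_sub_cancel, hE, ne_eq, not_true_eq_false, if_false] at ih ⊢
      linarith
    · rw [if_pos (by simpa using hE), card_insert_of_notMem (by simp)]
      push_cast
      linarith

theorem pcs_second_order_tracking_regret
    (K T S : ℕ) (hK : 0 < K) (hT : 0 < T) (hS : 0 < S) (hST : S ≤ T)
    (η : ℝ) (hη : 0 < η) (hη2 : η ≤ 1 / 2)
    (ℓ : ℕ → Fin K → ℝ)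
    (hℓ : ∀ t ∈ Finset.Icc 1 T, ∀ i, ℓ t i ∈ Set.Icc (0 : ℝ) 1)
    (w : ℕ → Fin K → ℝ)
    (hw1 : w 1 ∈ clippedSimplex K T S)
    (hmin : ∀ t ∈ Finset.Icc 1 T,
      w (t + 1) ∈ clippedSimplex K T S ∧
      ∀ v ∈ clippedSimplex K T S,
        ip (w (t + 1)) (fun i => -Real.log (1 - η * ℓ t i)) + breg (w (t + 1)) (w t)
          ≤ ip v (fun i => -Real.log (1 - η * ℓ t i)) + breg v (w t))
    (E : ℕ → Fin K)
    (hE : ((Finset.Icc 2 T).filter (fun t => E t ≠ E (t - 1))).card ≤ S - 1) :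
    ∑ t ∈ Finset.Icc 1 T, ip (w t) (ℓ t) - ∑ t ∈ Finset.Icc 1 T, ℓ t (E t)
      ≤ η * ∑ t ∈ Finset.Icc 1 T, (ℓ t (E t)) ^ 2
        + S * Real.log (K * T / S) / η + 3 * S / 2 := by
  have hKR : (0 : ℝ) < K := by exact_mod_cast hK
  have hTR : (0 : ℝ) < T := by exact_mod_cast hT
  have hS1 : (1 : ℝ) ≤ S := by exact_mod_cast hS
  have hw : ∀ t ∈ Icc 1 (T + 1), w t ∈ clippedSimplex K T S := by
    intro t ht
    obtain ⟨ht1, ht2⟩ := mem_Icc.mp ht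
    rcases Nat.exists_eq_add_of_le' ht1 with ⟨m, rfl⟩
    rcases Nat.eq_zero_or_pos m with rfl | hm
    · exact hw1
    · exact (hmin m (mem_Icc.mpr ⟨hm, by omega⟩)).1
  set r : ℝ := (S : ℝ) / T with hr
  have hr0 : 0 ≤ r := by positivity
  have hr1 : r ≤ 1 := (div_le_one hTR).mpr (by exact_mod_cast hST)
  have hrT : T * r = S := by rw [hr]; field_simp
  set L : ℝ := Real.log (K * T / S) with hL
  have hlo : ∀ t ∈ Icc 1 (T + 1), ∀ i, -L ≤ Real.log (w t i) := fun t ht i =>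
    clippedSimplex_neg_log_le hK hT hS (hw t ht) i
  have hhi : ∀ t ∈ Icc 1 (T + 1), ∀ i, Real.log (w t i) ≤ 0 := fun t ht i =>
    clippedSimplex_log_nonpos (hw t ht) i
  have hL0 : 0 ≤ L := by
    have hmem : 1 ∈ Icc 1 (T + 1) := by simp
    linarith [hlo 1 hmem (E 1), hhi 1 hmem (E 1)]
  have hstep : ∀ t ∈ Icc 1 T, η * ip (w t) (ℓ t) ≤
      (η * ℓ t (E t) + η ^ 2 * ℓ t (E t) ^ 2 + r * (η * (3 / 2)))
      + ((1 - r) * (Real.log (w (t + 1) (E t)) - Real.log (w t (E t)))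
      + r * (1 / K * ∑ i, (Real.log (w (t + 1) i) - Real.log (w t i)))) := by
    intro t ht
    have hx0 : ∀ i, 0 ≤ η * ℓ t i := fun i => mul_nonneg hη.le (hℓ t ht i).1
    have hxη : ∀ i, η * ℓ t i ≤ η := fun i => mul_le_of_le_one_right hη.le (hℓ t ht i).2
    have hc : ∀ i, -Real.log (1 - η * ℓ t i) ≤ η * ℓ t i + (η * ℓ t i) ^ 2 := fun i =>
      neg_log_one_sub_le (hx0 i) ((hxη i).trans hη2)
    have hc' : ∀ i, -Real.log (1 - η * ℓ t i) ≤ η * (3 / 2) := fun i => by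
      nlinarith [hc i, hx0 i, hxη i]
    have h := clippedSimplex_prod_step hK hT hS (fun i => by linarith [hxη i])
      (hw t (Icc_subset_Icc_right (Nat.le_succ T) ht)) (hmin t ht).1 (hmin t ht).2
      (clippedSimplex_mix_mem hK hT hST (E t))
    rw [sum_mix_mul, sum_mix_mul] at h
    have havg : 1 / (K : ℝ) * ∑ i, -Real.log (1 - η * ℓ t i) ≤ η * (3 / 2) := by
      rw [one_div_mul_eq_div, div_le_iff₀ hKR]
      refine (sum_le_card_nsmul _ _ _ fun i _ => hc' i).trans_eq ?_
      simp [mul_comm]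
    have hE1 : (1 - r) * -Real.log (1 - η * ℓ t (E t)) ≤ η * ℓ t (E t) + (η * ℓ t (E t)) ^ 2 :=
      (mul_le_mul_of_nonneg_left (hc _) (sub_nonneg.mpr hr1)).trans
        (mul_le_of_le_one_left (add_nonneg (hx0 _) (sq_nonneg _)) (by linarith))
    have := mul_le_mul_of_nonneg_left havg hr0
    rw [mul_pow] at hE1
    linarith
  have hsum := sum_le_sum hstep
  simp only [sum_add_distrib, ← mul_sum, sum_const, Nat.card_Icc, Nat.add_sub_cancel,
    nsmul_eq_mul] at hsum
  have htrack : ∑ t ∈ Icc 1 T, (Real.log (w (t + 1) (E t)) - Real.log (w t (E t))) ≤ S * L := by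
    have h := sum_tracking_le (fun t i => Real.log (w t i)) E hT hlo hhi
    have hcard : (#{t ∈ Icc 2 T | E t ≠ E (t - 1)} : ℝ) + 1 ≤ S := by
      exact_mod_cast (by omega : #{t ∈ Icc 2 T | E t ≠ E (t - 1)} + 1 ≤ S)
    nlinarith [hhi (T + 1) (by simp) (E T), mul_le_mul_of_nonneg_left hcard hL0]
  have hunif : 1 / (K : ℝ) * ∑ t ∈ Icc 1 T, ∑ i, (Real.log (w (t + 1) i) - Real.log (w t i))
      ≤ L := by
    rw [sum_comm, one_div_mul_eq_div, div_le_iff₀ hKR]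
    refine (sum_le_card_nsmul _ _ L fun i _ => ?_).trans_eq (by simp [mul_comm])
    have h := sum_tracking_le (fun t i => Real.log (w t i)) (fun _ => i) hT hlo hhi
    simp only [ne_eq, not_true_eq_false, filter_false, card_empty, Nat.cast_zero] at h
    linarith [hhi (T + 1) (by simp) i]
  have hpot := mul_le_mul_of_nonneg_left htrack (sub_nonneg.mpr hr1)
  have hpot' := mul_le_mul_of_nonneg_left hunif hr0
  have hrL : r * L ≤ r * (S * L) :=
    mul_le_mul_of_nonneg_left (le_mul_of_one_le_left hL0 hS1) hr0
  refine le_of_mul_le_mul_left ?_ hη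
  have hdiv : η * (S * L / η) = S * L := by field_simp
  have hTη : T * (r * (η * (3 / 2))) = S * (η * (3 / 2)) := by rw [← mul_assoc, hrT]
  rw [mul_sub, mul_add, mul_add, hdiv]
  linarith
end

section
/- Let K, T, S be positive integers with S ≤ T, let η > 0, let ℓ, ℓ' ∈ [0,1]^K, and let w̃ be an element of the clipped simplex Δ̃_K. Let w be the minimizer over Δ̃_K of v ↦ ⟨v, ηℓ'⟩ + D_φ(v‖w̃), and let w̃' be the minimizer over Δ̃_K of v ↦ ⟨v, ηℓ⟩ + D_φ(v‖w̃). Then ⟨w − w̃', ℓ − ℓ'⟩ ≤ η·‖ℓ − ℓ'‖_∞². -/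
open Finset

theorem convex_clippedSimplex (K T S : ℕ) : Convex ℝ (clippedSimplex K T S) := by
  rintro x ⟨⟨hx0, hx1⟩, hx⟩ y ⟨⟨hy0, hy1⟩, hy⟩ a b ha hb hab
  refine ⟨⟨fun i => ?_, ?_⟩, fun i => ?_⟩
  · simp only [Pi.add_apply, Pi.smul_apply, smul_eq_mul]
    have := hx0 i
    have := hy0 i
    positivity
  · simp only [Pi.add_apply, Pi.smul_apply, smul_eq_mul, sum_add_distrib, ← mul_sum, hx1, hy1]
    linarith
  · exact (convex_Ici ((S : ℝ) / (T * K))) (hx i) (hy i) ha hb hab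

theorem pos_of_mem_clippedSimplex {K T S : ℕ} (hT : 0 < T) (hS : 0 < S)
    {w : Fin K → ℝ} (hw : w ∈ clippedSimplex K T S) (i : Fin K) : 0 < w i := by
  have hK : 0 < K := i.pos
  exact lt_of_lt_of_le (by positivity) (hw.2 i)

theorem HasDerivAt.nonneg_of_le_of_mem_Ioc {g : ℝ → ℝ} {g' : ℝ} (hg : HasDerivAt g g' 0)
    (hmin : ∀ t ∈ Set.Ioc (0 : ℝ) 1, g 0 ≤ g t) : 0 ≤ g' := by
  refine ge_of_tendsto hg.tendsto_slope_zero_right ?_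
  filter_upwards [Ioc_mem_nhdsGT (zero_lt_one' ℝ)] with t ht
  have := hmin t ht
  rw [zero_add, smul_eq_mul]
  exact mul_nonneg (inv_nonneg.2 ht.1.le) (sub_nonneg.2 this)

/-- The first-order optimality condition for an entropic mirror step over a convex set. -/
theorem sum_mul_gradient_nonneg_of_isMinOn {K : ℕ} {s : Set (Fin K → ℝ)} (hs : Convex ℝ s)
    {c y w v : Fin K → ℝ} (hw : w ∈ s) (hv : v ∈ s) (hpos : ∀ i, 0 < w i)
    (hmin : ∀ u ∈ s, ip w c + breg w y ≤ ip u c + breg u y) :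
    0 ≤ ∑ i, (v i - w i) * (c i + Real.log (w i) - Real.log (y i)) := by
  have hline (i : Fin K) : HasDerivAt (fun t : ℝ => w i + t * (v i - w i)) (v i - w i) 0 := by
    simpa using ((hasDerivAt_id (0 : ℝ)).mul_const (v i - w i)).const_add (w i)
  have hlog (i : Fin K) := (hline i).log (by simpa using (hpos i).ne')
  have hip := HasDerivAt.fun_sum (u := univ) fun i _ => (hline i).mul_const (c i)
  have hent := HasDerivAt.fun_sum (u := univ) fun i _ => (hline i).fun_mul (hlog i)
  have hlin := HasDerivAt.fun_sum (u := univ) fun i _ =>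
    ((hline i).sub_const (y i)).mul_const (1 + Real.log (y i))
  have hderiv := hip.fun_add ((hent.sub_const (negEntropy y)).fun_sub hlin)
  have hnonneg := hderiv.nonneg_of_le_of_mem_Ioc fun t ht => by
    have hmem := hs.add_smul_sub_mem hw hv ⟨ht.1.le, ht.2⟩
    have := hmin _ hmem
    simpa [ip, breg, negEntropy] using this
  refine hnonneg.trans_eq ?_
  rw [← sum_sub_distrib, ← sum_add_distrib]
  refine sum_congr rfl fun i _ => ?_
  have := (hpos i).ne'
  simp only [zero_mul, add_zero]
  field_simp
  ring

theorem two_mul_sq_div_add_le_sub_mul_log_sub {x y : ℝ} (hx : 0 < x) (hy : 0 < y) :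
    2 * ((x - y) ^ 2 / (x + y)) ≤ (x - y) * (Real.log x - Real.log y) := by
  wlog hxy : y ≤ x generalizing x y
  · convert this hy hx (le_of_not_ge hxy) using 1
    · rw [add_comm y x]; ring
    · ring
  have h := Real.le_log_one_add_of_nonneg (x := (x - y) / y) (by
    have := sub_nonneg.2 hxy
    positivity)
  have h1 : 1 + (x - y) / y = x / y := by field_simp; ring
  have h2 : 2 * ((x - y) / y) / ((x - y) / y + 2) = 2 * (x - y) / (x + y) := by
    have : (x - y) / y + 2 = (x + y) / y := by field_simp; ring
    rw [this]
    field_simp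
  rw [h1, h2, Real.log_div hx.ne' hy.ne'] at h
  calc 2 * ((x - y) ^ 2 / (x + y)) = (x - y) * (2 * (x - y) / (x + y)) := by ring
    _ ≤ _ := mul_le_mul_of_nonneg_left h (sub_nonneg.2 hxy)

/-- The symmetrized Pinsker inequality on a finite type. -/
theorem sq_sum_abs_sub_le_sum_sub_mul_log_sub {ι : Type*} [Fintype ι] {x y : ι → ℝ}
    (hx : ∀ i, 0 < x i) (hy : ∀ i, 0 < y i) (hx1 : ∑ i, x i = 1) (hy1 : ∑ i, y i = 1) :
    (∑ i, |x i - y i|) ^ 2 ≤ ∑ i, (x i - y i) * (Real.log (x i) - Real.log (y i)) := by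
  have h := sq_sum_div_le_sum_sq_div univ (fun i => |x i - y i|)
    (g := fun i => x i + y i) fun i _ => add_pos (hx i) (hy i)
  simp only [sq_abs, sum_add_distrib, hx1, hy1] at h
  calc (∑ i, |x i - y i|) ^ 2 ≤ 2 * ∑ i, (x i - y i) ^ 2 / (x i + y i) := by linarith
    _ ≤ _ := by
      rw [mul_sum]
      exact sum_le_sum fun i _ => two_mul_sq_div_add_le_sub_mul_log_sub (hx i) (hy i)

theorem ip_le_sum_abs_mul_norm {K : ℕ} (x y : Fin K → ℝ) : ip x y ≤ (∑ i, |x i|) * ‖y‖ := by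
  rw [ip, sum_mul]
  refine sum_le_sum fun i _ => (le_abs_self _).trans ?_
  rw [abs_mul]
  exact mul_le_mul_of_nonneg_left (norm_le_pi_norm y i) (abs_nonneg _)

theorem optimistic_step_path_length_bound
    (K T S : ℕ) (hK : 0 < K) (hT : 0 < T) (hS : 0 < S) (hST : S ≤ T)
    (η : ℝ) (hη : 0 < η)
    (ℓ ℓ' : Fin K → ℝ)
    (hℓ : ∀ i, ℓ i ∈ Set.Icc (0 : ℝ) 1) (hℓ' : ∀ i, ℓ' i ∈ Set.Icc (0 : ℝ) 1)
    (wt : Fin K → ℝ) (hwt : wt ∈ clippedSimplex K T S)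
    (w : Fin K → ℝ)
    (hw : w ∈ clippedSimplex K T S ∧
      ∀ v ∈ clippedSimplex K T S,
        ip w (η • ℓ') + breg w wt ≤ ip v (η • ℓ') + breg v wt)
    (wt' : Fin K → ℝ)
    (hwt' : wt' ∈ clippedSimplex K T S ∧
      ∀ v ∈ clippedSimplex K T S,
        ip wt' (η • ℓ) + breg wt' wt ≤ ip v (η • ℓ) + breg v wt) :
    ip (w - wt') (ℓ - ℓ') ≤ η * ‖ℓ - ℓ'‖ ^ 2 := by
  have hpos := pos_of_mem_clippedSimplex hT hS hw.1
  have hpos' := pos_of_mem_clippedSimplex hT hS hwt'.1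
  have hconv := convex_clippedSimplex K T S
  have h1 := sum_mul_gradient_nonneg_of_isMinOn hconv hw.1 hwt'.1 hpos hw.2
  have h2 := sum_mul_gradient_nonneg_of_isMinOn hconv hwt'.1 hw.1 hpos' hwt'.2
  have h3 := sq_sum_abs_sub_le_sum_sub_mul_log_sub hpos hpos' hw.1.1.2 hwt'.1.1.2
  have h4 := ip_le_sum_abs_mul_norm (w - wt') (ℓ - ℓ')
  have hsum : (∑ i, (w i - wt' i) * (Real.log (w i) - Real.log (wt' i))) ≤
      η * ip (w - wt') (ℓ - ℓ') := by
    rw [← sub_nonneg]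
    refine (add_nonneg h1 h2).trans_eq ?_
    rw [ip, mul_sum, ← sum_add_distrib, ← sum_sub_distrib]
    refine sum_congr rfl fun i _ => ?_
    simp only [Pi.sub_apply, Pi.smul_apply, smul_eq_mul]
    ring
  have h5 := h3.trans hsum
  simp only [Pi.sub_apply] at h4
  set a := ip (w - wt') (ℓ - ℓ')
  set d := ∑ i, |w i - wt' i|
  set L := ‖ℓ - ℓ'‖
  rcases le_or_gt a 0 with ha | ha
  · exact ha.trans (by positivity)
  · refine le_of_mul_le_mul_right ?_ ha
    calc a * a ≤ (d * L) * (d * L) := mul_self_le_mul_self ha.le h4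
      _ = L ^ 2 * d ^ 2 := by ring
      _ ≤ L ^ 2 * (η * a) := mul_le_mul_of_nonneg_left h5 (sq_nonneg L)
      _ = η * L ^ 2 * a := by ring
end
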